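/- Let n ≥ 2. There exist constants d₀ ∈ (0,1) and c > 0 depending only on a, n, D and T such that whenever h = dσ with 0 < d ≤ d₀, for every t ∈ [0,T] and every v_σ ∈ V_σ^n(Ω): Σ_{i=1}^N w_i v_σ(x_i(t))² ≥ c ‖v_σ‖²_{L²(Ω)}. In particular the symmetric bilinear form (u,v) ↦ Σ_{i=1}^N w_i u(x_i(t)) v(x_i(t)) is positive definite on V_σ^n(Ω). -/

import Mathlib

open MeasureTheory
open scoped ENNReal NNReal

noncomputable section

/-- The open unit cube `Ω = (0,1)^D`. -/
def unitCube (D : ℕ) : Set (Fin D → ℝ) := {x | ∀ i, x i ∈ Set.Ioo (0 : ℝ) 1}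

/-- The grid cell with multi-index `k` in the uniform partition of the unit cube into
`M^D` cubes of edge length `1/M`. -/
def cell (D M : ℕ) (k : Fin D → Fin M) : Set (Fin D → ℝ) :=
  {x | ∀ i, ((k i : ℕ) : ℝ) / M ≤ x i ∧ x i < (((k i : ℕ) : ℝ) + 1) / M}

/-- Membership in the tensor-product spline space `V_σ^n(Ω)`, `σ = 1/M`: the function is
`C^{n-2}` on `Ω` and coincides on every grid cell with a polynomial of coordinate-wise
degree at most `n-1`. -/
def IsSpline (D M n : ℕ) (u : (Fin D → ℝ) → ℝ) : Prop :=
  ContDiffOn ℝ (n - 2 : ℕ) u (unitCube D) ∧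
  ∀ k : Fin D → Fin M, ∃ p : MvPolynomial (Fin D) ℝ,
    (∀ i, p.degreeOf i ≤ n - 1) ∧ ∀ x ∈ cell D M k, u x = MvPolynomial.eval x p

/-- A smooth, bounded, divergence-free velocity field `a` on `Ω × [0,T]`, tangent to the
boundary of the unit cube, together with its flow maps: `X τ t = X_{τ→t}`, so that
`X τ t x` is the position at time `t` of the trajectory passing through `x` at time `τ`. -/
structure FlowData (D : ℕ) (T : ℝ) where
  a : (Fin D → ℝ) → ℝ → (Fin D → ℝ)
  X : ℝ → ℝ → (Fin D → ℝ) → (Fin D → ℝ)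
  smooth : ContDiff ℝ (⊤ : ℕ∞) (Function.uncurry a)
  bounded : ∃ B, ∀ x t, ‖a x t‖ ≤ B
  div_free : ∀ x t, ∑ i, fderiv ℝ (fun y => a y t i) x (Pi.single i 1) = 0
  tangent : ∀ t ∈ Set.Icc (0 : ℝ) T, ∀ x ∈ closure (unitCube D), ∀ i,
      (x i = 0 ∨ x i = 1) → a x t i = 0
  flow_init : ∀ τ x, X τ τ x = x
  flow_ode : ∀ τ x t, HasDerivAt (fun s => X τ s x) (a (X τ t x) t) t
  flow_inv : ∀ τ t x, X t τ (X τ t x) = x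

theorem aux_hasDerivAt_max_sq (u : ℝ) :
    HasDerivAt (fun u : ℝ => (max u 0) ^ 2) (2 * max u 0) u := by
  rcases lt_trichotomy u 0 with h | h | h
  · rw [max_eq_right h.le]
    have : (fun u : ℝ => (max u 0) ^ 2) =ᶠ[nhds u] fun _ => 0 := by
      filter_upwards [Iio_mem_nhds h] with y hy
      simp [max_eq_right (Set.mem_Iio.1 hy).le]
    simpa using (hasDerivAt_const u (0 : ℝ)).congr_of_eventuallyEq this
  · subst h
    have : HasFDerivAt (fun u : ℝ => (max u 0) ^ 2) (0 : ℝ →L[ℝ] ℝ) 0 := by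
      apply Asymptotics.IsBigO.hasFDerivAt (n := 2) _ (by norm_num)
      apply Asymptotics.IsBigO.of_bound 1
      filter_upwards with y
      simp only [sub_zero, norm_pow, Real.norm_eq_abs, one_mul, abs_abs]
      apply pow_le_pow_left₀ (abs_nonneg _)
      rw [abs_of_nonneg (le_max_right _ _)]
      exact max_le (le_abs_self _) (abs_nonneg _)
    simpa using this.hasDerivAt
  · rw [max_eq_left h.le]
    have : (fun u : ℝ => (max u 0) ^ 2) =ᶠ[nhds u] fun u => u ^ 2 := by
      filter_upwards [Ioi_mem_nhds h] with y hy
      simp [max_eq_left (Set.mem_Ioi.1 hy).le]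
    simpa using (hasDerivAt_pow 2 u).congr_of_eventuallyEq this

/-- The clamp of a real to the unit interval. -/
def clamp1 (u : ℝ) : ℝ := max 0 (min u 1)

theorem aux_clamp_sub (u : ℝ) : u - clamp1 u = max (u - 1) 0 - max (-u) 0 := by
  unfold clamp1
  rcases le_total u 0 with h | h
  · rw [min_eq_left (by linarith), max_eq_left h, max_eq_right (by linarith),
      max_eq_left (by linarith)]; ring
  · rcases le_total u 1 with h1 | h1
    · rw [min_eq_left h1, max_eq_right h, max_eq_right (by linarith), max_eq_right (by linarith)]
      ring
    · rw [min_eq_right h1, max_eq_right (by norm_num), max_eq_left (by linarith),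
        max_eq_right (by linarith)]; ring

theorem aux_clamp_deriv (u : ℝ) :
    HasDerivAt (fun u : ℝ => (u - clamp1 u) ^ 2) (2 * (u - clamp1 u)) u := by
  have h1 : HasDerivAt (fun u : ℝ => (max (u - 1) 0) ^ 2) (2 * max (u - 1) 0) u := by
    simpa [Function.comp_def] using (aux_hasDerivAt_max_sq (u - 1)).comp u ((hasDerivAt_id u).sub_const 1)
  have h2 : HasDerivAt (fun u : ℝ => (max (-u) 0) ^ 2) (-(2 * max (-u) 0)) u := by
    simpa [Function.comp_def] using (aux_hasDerivAt_max_sq (-u)).comp u (hasDerivAt_neg u)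
  have h3 := h1.fun_add h2
  have e1 : (fun u : ℝ => (u - clamp1 u) ^ 2)
      = fun y : ℝ => (max (y - 1) 0) ^ 2 + (max (-y) 0) ^ 2 := by
    funext y
    rw [aux_clamp_sub]
    have : max (y - 1) 0 * max (-y) 0 = 0 := by
      rcases le_total y 0 with h | h
      · rw [max_eq_right (by linarith : y - 1 ≤ 0)]; simp
      · rw [max_eq_right (by linarith : -y ≤ 0)]; simp
    linear_combination (-2) * this
  have e2 : 2 * (u - clamp1 u) = 2 * max (u - 1) 0 + -(2 * max (-u) 0) := by
    rw [aux_clamp_sub]; ring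
  rw [e1, e2]
  exact h3

theorem aux_clamp_mem (u : ℝ) : 0 ≤ clamp1 u ∧ clamp1 u ≤ 1 := by
  unfold clamp1
  exact ⟨le_max_left _ _, max_le (by norm_num) (min_le_right _ _)⟩

theorem aux_clamp_of_mem {u : ℝ} (h : 0 ≤ u ∧ u ≤ 1) : clamp1 u = u := by
  unfold clamp1
  rw [min_eq_left h.2, max_eq_right h.1]

theorem aux_clamp_bd {u : ℝ} (h : u - clamp1 u ≠ 0) : clamp1 u = 0 ∨ clamp1 u = 1 := by
  unfold clamp1 at *
  rcases le_total u 0 with h1 | h1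
  · left; rw [min_eq_left (by linarith), max_eq_left h1]
  · rcases le_total u 1 with h2 | h2
    · exfalso; apply h; rw [min_eq_left h2, max_eq_right h1]; ring
    · right; rw [min_eq_right h2, max_eq_right (by norm_num)]

theorem aux_closure_unitCube {D : ℕ} {x : Fin D → ℝ} (h : ∀ i, 0 ≤ x i ∧ x i ≤ 1) :
    x ∈ closure (unitCube D) := by
  have : unitCube D = Set.pi Set.univ (fun _ => Set.Ioo (0 : ℝ) 1) := by
    ext y; simp [unitCube]
  rw [this, closure_pi_set]
  intro i _
  simpa [closure_Ioo (zero_ne_one (α := ℝ))] using h i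

/-- speed bound -/
theorem aux_dist {D : ℕ} {T : ℝ} (F : FlowData D T) {B : ℝ} (hB : ∀ x t, ‖F.a x t‖ ≤ B)
    (τ : ℝ) (x : Fin D → ℝ) (s : ℝ) : ‖F.X τ s x - x‖ ≤ B * |s - τ| := by
  have := Convex.norm_image_sub_le_of_norm_hasDerivWithin_le (f := fun s => F.X τ s x)
    (f' := fun s => F.a (F.X τ s x) s) (s := Set.univ) (C := B) (x := τ) (y := s)
    (fun r _ => (F.flow_ode τ x r).hasDerivWithinAt) (fun r _ => hB _ _) convex_univ
    (Set.mem_univ _) (Set.mem_univ _)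
  simpa [F.flow_init] using this

theorem aux_norm_le_one {D : ℕ} {x : Fin D → ℝ} (h : ∀ i, 0 ≤ x i ∧ x i ≤ 1) : ‖x‖ ≤ 1 := by
  rw [pi_norm_le_iff_of_nonneg (by norm_num)]
  intro i
  rw [Real.norm_eq_abs, abs_of_nonneg (h i).1]; exact (h i).2

theorem aux_lip {D : ℕ} {T : ℝ} (F : FlowData D T) (R : ℝ) :
    ∃ C : ℝ≥0, ∀ s ∈ Set.Icc (0 : ℝ) T,
      LipschitzOnWith C (fun x => F.a x s) (Metric.closedBall 0 R) := by
  have hc : IsCompact ((Metric.closedBall (0 : Fin D → ℝ) R) ×ˢ (Set.Icc (0 : ℝ) T)) :=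
    (isCompact_closedBall _ _).prod isCompact_Icc
  obtain ⟨C, hC⟩ := (F.smooth.contDiffOn (s := (Metric.closedBall (0 : Fin D → ℝ) R) ×ˢ (Set.Icc (0 : ℝ) T))).exists_lipschitzOnWith
    (by simp) ((convex_closedBall _ _).prod (convex_Icc _ _)) hc
  refine ⟨C, fun s hs => ?_⟩
  intro x hx y hy
  have := hC (x := (x, s)) ⟨hx, hs⟩ (y := (y, s)) ⟨hy, hs⟩
  simpa [Function.uncurry, Prod.edist_eq] using this

theorem aux_invariant {D : ℕ} {T : ℝ} (F : FlowData D T) (t : ℝ) (ht : t ∈ Set.Icc (0 : ℝ) T)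
    (Z : Fin D → ℝ) (hZ : ∀ i, 0 ≤ Z i ∧ Z i ≤ 1) :
    ∀ i, 0 ≤ F.X t 0 Z i ∧ F.X t 0 Z i ≤ 1 := by
  obtain ⟨B, hB⟩ := F.bounded
  have hB0 : 0 ≤ B := (norm_nonneg _).trans (hB 0 0)
  obtain ⟨C, hC⟩ := aux_lip F (1 + B * T)
  have hT0 : 0 ≤ T := ht.1.trans ht.2
  -- the reversed trajectory
  set x : ℝ → Fin D → ℝ := fun s => F.X t (t - s) Z with hx
  have hxd : ∀ s, HasDerivAt x (-(F.a (x s) (t - s))) s := by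
    intro s
    have h := (F.flow_ode t Z (t - s)).scomp s ((hasDerivAt_id s).const_sub t)
    simpa [Function.comp_def] using h
  have hxi : ∀ s i, HasDerivAt (fun s => x s i) (-(F.a (x s) (t - s) i)) s := by
    intro s i
    have := (hasDerivAt_pi.1 (hxd s)) i
    simpa using this
  set φ : ℝ → ℝ := fun s => ∑ i, (x s i - clamp1 (x s i)) ^ 2 with hφ
  have hφd : ∀ s, HasDerivAt φ
      (∑ i, 2 * (x s i - clamp1 (x s i)) * (-(F.a (x s) (t - s) i))) s := by
    intro s
    apply HasDerivAt.fun_sum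
    intro i _
    exact (aux_clamp_deriv (x s i)).comp s (hxi s i)
  have hx0 : x 0 = Z := by simp [hx, F.flow_init]
  have hφ0 : φ 0 = 0 := by
    simp only [hφ, hx0]
    apply Finset.sum_eq_zero
    intro i _
    rw [aux_clamp_of_mem (hZ i)]; simp
  have hnn : ∀ s, 0 ≤ φ s := fun s => Finset.sum_nonneg fun i _ => sq_nonneg _
  have key := norm_le_gronwallBound_of_norm_deriv_right_le (f := φ)
    (f' := fun s => ∑ i, 2 * (x s i - clamp1 (x s i)) * (-(F.a (x s) (t - s) i)))
    (δ := 0) (K := D * (2 * C)) (ε := 0) (a := 0) (b := t)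
    (fun s _ => (hφd s).continuousAt.continuousWithinAt)
    (fun s _ => (hφd s).hasDerivWithinAt) (by simp [hφ0]) (by
      intro s hs
      have hts : t - s ∈ Set.Icc (0 : ℝ) T := ⟨by linarith [hs.2], by linarith [hs.1, ht.2]⟩
      set P : Fin D → ℝ := fun i => clamp1 (x s i) with hP
      have hPm : ∀ i, 0 ≤ P i ∧ P i ≤ 1 := fun i => aux_clamp_mem _
      have hPb : P ∈ Metric.closedBall (0 : Fin D → ℝ) (1 + B * T) := by
        rw [mem_closedBall_zero_iff]
        linarith [aux_norm_le_one hPm, mul_nonneg hB0 hT0]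
      have hxb : x s ∈ Metric.closedBall (0 : Fin D → ℝ) (1 + B * T) := by
        rw [mem_closedBall_zero_iff]
        have h1 := aux_dist F hB t Z (t - s)
        have h2 : |t - s - t| ≤ T := by
          rw [abs_le]; constructor <;> linarith [hs.1, hs.2, ht.2]
        have h3 : ‖x s‖ ≤ ‖x s - Z‖ + ‖Z‖ := by simpa using norm_add_le (x s - Z) Z
        have h4 := mul_le_mul_of_nonneg_left h2 hB0
        linarith [aux_norm_le_one hZ]
      have hl : ‖F.a (x s) (t - s) - F.a P (t - s)‖ ≤ C * ‖x s - P‖ := by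
        have := (hC _ hts).dist_le_mul _ hxb _ hPb
        simpa [dist_eq_norm] using this
      have hnsq : ‖x s - P‖ ^ 2 ≤ φ s := by
        rw [← Real.sqrt_le_sqrt_iff (hnn s), Real.sqrt_sq (norm_nonneg _),
          pi_norm_le_iff_of_nonneg (Real.sqrt_nonneg _)]
        intro i
        apply Real.le_sqrt_of_sq_le
        rw [Real.norm_eq_abs, sq_abs]
        exact Finset.single_le_sum (f := fun i => (x s i - clamp1 (x s i)) ^ 2)
          (fun i _ => sq_nonneg _) (Finset.mem_univ i)
      have hterm : ∀ i, ‖2 * (x s i - clamp1 (x s i)) * (-(F.a (x s) (t - s) i))‖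
          ≤ 2 * C * φ s := by
        intro i
        by_cases h0 : x s i - clamp1 (x s i) = 0
        · rw [h0]
          have := mul_nonneg (mul_nonneg zero_le_two C.2) (hnn s)
          simpa using this
        · have ha0 : F.a P (t - s) i = 0 :=
            F.tangent _ hts P (aux_closure_unitCube hPm) i (aux_clamp_bd h0)
          have h1 : |F.a (x s) (t - s) i| ≤ C * ‖x s - P‖ := by
            refine le_trans ?_ hl
            have := norm_le_pi_norm (F.a (x s) (t - s) - F.a P (t - s)) i
            simpa [ha0] using this
          have h2 : |x s i - clamp1 (x s i)| ≤ ‖x s - P‖ := by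
            have := norm_le_pi_norm (x s - P) i
            simpa using this
          rw [norm_mul, norm_mul, norm_neg, Real.norm_eq_abs, Real.norm_eq_abs, Real.norm_eq_abs,
            abs_two]
          calc 2 * |x s i - clamp1 (x s i)| * |F.a (x s) (t - s) i|
              ≤ 2 * ‖x s - P‖ * (C * ‖x s - P‖) := by gcongr
            _ = 2 * C * ‖x s - P‖ ^ 2 := by ring
            _ ≤ 2 * C * φ s := by gcongr
      calc ‖∑ i, 2 * (x s i - clamp1 (x s i)) * (-(F.a (x s) (t - s) i))‖
          ≤ ∑ i, ‖2 * (x s i - clamp1 (x s i)) * (-(F.a (x s) (t - s) i))‖ := norm_sum_le _ _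
        _ ≤ ∑ _i : Fin D, 2 * C * φ s := Finset.sum_le_sum fun i _ => hterm i
        _ = D * (2 * C) * ‖φ s‖ + 0 := by
          rw [Real.norm_eq_abs, abs_of_nonneg (hnn s)]; simp; ring)
    t ⟨ht.1, le_rfl⟩
  have hz : φ t = 0 := by
    have h := key
    rw [gronwallBound_ε0] at h
    simpa using h
  have hxt : x t = F.X t 0 Z := by simp [hx]
  intro i
  have := (Finset.sum_eq_zero_iff_of_nonneg (fun i _ => sq_nonneg _)).1 hz i (Finset.mem_univ i)
  have h0 : x t i = clamp1 (x t i) := by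
    have := pow_eq_zero_iff (two_ne_zero) |>.1 this
    linarith
  rw [← hxt, h0]
  exact aux_clamp_mem _

theorem aux_flow_lip {D : ℕ} {T : ℝ} (F : FlowData D T) :
    ∃ L : ℝ, 1 ≤ L ∧ ∀ t ∈ Set.Icc (0 : ℝ) T, ∀ x y : Fin D → ℝ,
      (∀ i, 0 ≤ x i ∧ x i ≤ 1) → (∀ i, 0 ≤ y i ∧ y i ≤ 1) →
      ‖F.X 0 t x - F.X 0 t y‖ ≤ L * ‖x - y‖ := by
  obtain ⟨B, hB⟩ := F.bounded
  have hB0 : 0 ≤ B := (norm_nonneg _).trans (hB 0 0)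
  obtain ⟨C, hC⟩ := aux_lip F (1 + B * T)
  refine ⟨Real.exp (C * |T|), Real.one_le_exp (by positivity), ?_⟩
  intro t ht x y hx hy
  have hT0 : 0 ≤ T := ht.1.trans ht.2
  have hb : ∀ z : Fin D → ℝ, (∀ i, 0 ≤ z i ∧ z i ≤ 1) → ∀ s ∈ Set.Ico 0 T,
      F.X 0 s z ∈ Metric.closedBall (0 : Fin D → ℝ) (1 + B * T) := by
    intro z hz s hs
    rw [mem_closedBall_zero_iff]
    have h1 := aux_dist F hB 0 z s
    have h2 : |s - 0| ≤ T := by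
      rw [abs_le]; constructor <;> linarith [hs.1, hs.2]
    have h3 : ‖F.X 0 s z‖ ≤ ‖F.X 0 s z - z‖ + ‖z‖ := by
      simpa using norm_add_le (F.X 0 s z - z) z
    have h4 := mul_le_mul_of_nonneg_left h2 hB0
    linarith [aux_norm_le_one hz]
  have := dist_le_of_trajectories_ODE_of_mem (v := fun s z => F.a z s)
    (s := fun _ => Metric.closedBall (0 : Fin D → ℝ) (1 + B * T)) (K := C) (a := 0) (b := T)
    (f := fun s => F.X 0 s x) (g := fun s => F.X 0 s y) (δ := ‖x - y‖)
    (fun s hs => hC s ⟨hs.1, hs.2.le⟩)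
    (fun s _ => (F.flow_ode 0 x s).continuousAt.continuousWithinAt)
    (fun s _ => (F.flow_ode 0 x s).hasDerivWithinAt) (hb x hx)
    (fun s _ => (F.flow_ode 0 y s).continuousAt.continuousWithinAt)
    (fun s _ => (F.flow_ode 0 y s).hasDerivWithinAt) (hb y hy)
    (by simp [F.flow_init, dist_eq_norm]) t ht
  rw [dist_eq_norm] at this
  refine this.trans ?_
  rw [mul_comm]
  apply mul_le_mul_of_nonneg_right _ (norm_nonneg _)
  apply Real.exp_le_exp.2
  apply mul_le_mul_of_nonneg_left _ C.2
  rw [abs_of_nonneg hT0]; linarith [ht.2]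

/-- Tensor-product polynomial with coefficient vector `c`. -/
def qev {D n : ℕ} (c : (Fin D → Fin n) → ℝ) (x : Fin D → ℝ) : ℝ :=
  ∑ α, c α * ∏ i, x i ^ (α i : ℕ)

theorem aux_qev_smul {D n : ℕ} (r : ℝ) (c : (Fin D → Fin n) → ℝ) (x : Fin D → ℝ) :
    qev (r • c) x = r * qev c x := by
  simp [qev, Finset.mul_sum, mul_assoc]

theorem aux_qev_ne {D n : ℕ} (c : (Fin D → Fin n) → ℝ) (hc : c ≠ 0) :
    ∃ z ∈ unitCube D, qev c z ≠ 0 := by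
  by_contra hcon
  push Not at hcon
  apply hc
  set e : (Fin D → Fin n) → (Fin D →₀ ℕ) :=
    fun α => Finsupp.equivFunOnFinite.symm (fun i => (α i : ℕ)) with he
  have hinj : Function.Injective e := by
    intro α β h
    funext i
    have := DFunLike.congr_fun h i
    simp only [he, Finsupp.equivFunOnFinite_symm_apply_apply] at this
    exact Fin.ext this
  set p : MvPolynomial (Fin D) ℝ := ∑ α, MvPolynomial.monomial (e α) (c α) with hp
  have hev : ∀ x, MvPolynomial.eval x p = qev c x := by
    intro x
    simp only [hp, map_sum, MvPolynomial.eval_monomial, qev]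
    refine Finset.sum_congr rfl fun α _ => ?_
    rw [Finsupp.prod_fintype _ _ (by simp)]
    simp [he]
  have hp0 : p = 0 := by
    apply MvPolynomial.funext_set (fun _ => Set.Ioo (0 : ℝ) 1)
      (fun _ => Set.Ioo_infinite (by norm_num))
    intro x hx
    rw [hev, map_zero]
    exact hcon x (fun i => hx i (Set.mem_univ i))
  funext α
  have := congrArg (MvPolynomial.coeff (e α)) hp0
  simpa [hp, MvPolynomial.coeff_sum, MvPolynomial.coeff_monomial, hinj.eq_iff] using this

theorem aux_isOpen_unitCube (D : ℕ) : IsOpen (unitCube D) := by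
  have : unitCube D = Set.pi Set.univ (fun _ => Set.Ioo (0 : ℝ) 1) := by
    ext y; simp [unitCube]
  rw [this]
  exact isOpen_set_pi Set.finite_univ fun _ _ => isOpen_Ioo

theorem aux_qev_cont (D n : ℕ) :
    Continuous (fun q : ((Fin D → Fin n) → ℝ) × (Fin D → ℝ) => qev q.1 q.2) := by
  unfold qev
  fun_prop

theorem aux_compact (D n : ℕ) : ∃ ε r : ℝ, 0 < ε ∧ 0 < r ∧ r ≤ 1 ∧
    ∀ c : (Fin D → Fin n) → ℝ, c ≠ 0 → ∃ z, z ∈ unitCube D ∧ Metric.ball z r ⊆ unitCube D ∧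
      ∀ x ∈ Metric.ball z r, ε * ‖c‖ ≤ |qev c x| := by
  have h : ∃ ε r : ℝ, 0 < ε ∧ 0 < r ∧ r ≤ 1 ∧
      ∀ c ∈ Metric.sphere (0 : (Fin D → Fin n) → ℝ) 1, ∃ z, z ∈ unitCube D ∧
        Metric.ball z r ⊆ unitCube D ∧ ∀ x ∈ Metric.ball z r, ε ≤ |qev c x| := by
    apply IsCompact.induction_on (p := fun S => ∃ ε r : ℝ, 0 < ε ∧ 0 < r ∧ r ≤ 1 ∧
      ∀ c ∈ S, ∃ z, z ∈ unitCube D ∧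
        Metric.ball z r ⊆ unitCube D ∧ ∀ x ∈ Metric.ball z r, ε ≤ |qev c x|)
      (isCompact_sphere (0 : (Fin D → Fin n) → ℝ) 1)
    · exact ⟨1, 1, one_pos, one_pos, le_rfl, by simp⟩
    · rintro s t hst ⟨ε, r, h1, h2, h3, h4⟩
      exact ⟨ε, r, h1, h2, h3, fun c hc => h4 c (hst hc)⟩
    · rintro s t ⟨ε, r, h1, h2, h3, h4⟩ ⟨ε', r', h1', h2', h3', h4'⟩
      refine ⟨min ε ε', min r r', lt_min h1 h1', lt_min h2 h2', (min_le_left _ _).trans h3, ?_⟩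
      rintro c (hc | hc)
      · obtain ⟨z, hz0, hz, hz'⟩ := h4 c hc
        have hs : Metric.ball z (min r r') ⊆ Metric.ball z r :=
          Metric.ball_subset_ball (min_le_left _ _)
        exact ⟨z, hz0, hs.trans hz, fun x hx => (min_le_left _ _).trans (hz' x (hs hx))⟩
      · obtain ⟨z, hz0, hz, hz'⟩ := h4' c hc
        have hs : Metric.ball z (min r r') ⊆ Metric.ball z r' :=
          Metric.ball_subset_ball (min_le_right _ _)
        exact ⟨z, hz0, hs.trans hz, fun x hx => (min_le_right _ _).trans (hz' x (hs hx))⟩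
    · intro c hc
      have hc0 : c ≠ 0 := by
        rintro rfl; simp at hc
      obtain ⟨z, hz, hne⟩ := aux_qev_ne c hc0
      have hpos : 0 < |qev c z| := abs_pos.2 hne
      have hev : ∀ᶠ q : ((Fin D → Fin n) → ℝ) × (Fin D → ℝ) in nhds (c, z),
          |qev c z| / 2 < |qev q.1 q.2| ∧ q.2 ∈ unitCube D := by
        apply Filter.Eventually.and
        · exact (aux_qev_cont D n).abs.continuousAt.eventually_const_lt (half_lt_self hpos)
        · exact continuous_snd.continuousAt.eventually_mem ((aux_isOpen_unitCube D).mem_nhds hz)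
      rw [Metric.eventually_nhds_iff_ball] at hev
      obtain ⟨δ, hδ, hball⟩ := hev
      refine ⟨Metric.ball c δ, mem_nhdsWithin_of_mem_nhds (Metric.ball_mem_nhds _ hδ),
        |qev c z| / 2, min δ 1, half_pos hpos, lt_min hδ one_pos, min_le_right _ _, ?_⟩
      intro c' hc'
      have hall : ∀ x ∈ Metric.ball z (min δ 1),
          |qev c z| / 2 < |qev c' x| ∧ x ∈ unitCube D := by
        intro x hx
        apply hball (c', x)
        rw [← ball_prod_same]
        exact ⟨hc', Metric.ball_subset_ball (min_le_left _ _) hx⟩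
      exact ⟨z, hz, fun x hx => (hall x hx).2, fun x hx => (hall x hx).1.le⟩
  obtain ⟨ε, r, h1, h2, h3, h4⟩ := h
  refine ⟨ε, r, h1, h2, h3, fun c hc => ?_⟩
  have hn : 0 < ‖c‖ := norm_pos_iff.2 hc
  obtain ⟨z, hz0, hz, hz'⟩ := h4 (‖c‖⁻¹ • c) (by
    rw [mem_sphere_zero_iff_norm, norm_smul, norm_inv, norm_norm, inv_mul_cancel₀ hn.ne'])
  refine ⟨z, hz0, hz, fun x hx => ?_⟩
  have := hz' x hx
  rw [aux_qev_smul, abs_mul, abs_inv, abs_norm, inv_mul_eq_div, le_div_iff₀ hn] at this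
  exact this

theorem aux_qev_le {D n : ℕ} (c : (Fin D → Fin n) → ℝ) (x : Fin D → ℝ)
    (hx : ∀ i, 0 ≤ x i ∧ x i ≤ 1) :
    |qev c x| ≤ (Fintype.card (Fin D → Fin n) : ℝ) * ‖c‖ := by
  calc |qev c x| ≤ ∑ α, |c α * ∏ i, x i ^ (α i : ℕ)| := Finset.abs_sum_le_sum_abs _ _
    _ ≤ ∑ _α : Fin D → Fin n, ‖c‖ := by
      refine Finset.sum_le_sum fun α _ => ?_
      rw [abs_mul]
      have h1 : |c α| ≤ ‖c‖ := norm_le_pi_norm c α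
      have h2 : |∏ i, x i ^ (α i : ℕ)| ≤ 1 := by
        rw [abs_of_nonneg (Finset.prod_nonneg fun i _ => pow_nonneg (hx i).1 _)]
        exact Finset.prod_le_one (fun i _ => pow_nonneg (hx i).1 _)
          (fun i _ => pow_le_one₀ (hx i).1 (hx i).2)
      calc |c α| * |∏ i, x i ^ (α i : ℕ)| ≤ ‖c‖ * 1 := by gcongr
        _ = ‖c‖ := mul_one _
    _ = _ := by simp

theorem aux_repr {D n : ℕ} (hn : 1 ≤ n) (p : MvPolynomial (Fin D) ℝ)
    (hp : ∀ i, p.degreeOf i ≤ n - 1) (a : Fin D → ℝ) (b : ℝ) :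
    ∃ c : (Fin D → Fin n) → ℝ, ∀ x : Fin D → ℝ,
      MvPolynomial.eval (fun i => a i + b * x i) p = qev c x := by
  set P : Fin D → ℕ → Polynomial ℝ :=
    fun i s => (Polynomial.C (a i) + Polynomial.C b * Polynomial.X) ^ s with hP
  have hdeg : ∀ i s, (P i s).natDegree ≤ s := by
    intro i s
    refine Polynomial.natDegree_pow_le.trans ?_
    have : (Polynomial.C (a i) + Polynomial.C b * Polynomial.X).natDegree ≤ 1 := by
      compute_degree
    nlinarith
  refine ⟨fun α => ∑ d ∈ p.support, p.coeff d * ∏ i, (P i (d i)).coeff (α i), fun x => ?_⟩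
  rw [MvPolynomial.eval_eq']
  unfold qev
  simp_rw [Finset.sum_mul]
  rw [Finset.sum_comm]
  refine Finset.sum_congr rfl fun d hd => ?_
  have hterm : ∀ i, (a i + b * x i) ^ d i = ∑ j : Fin n, (P i (d i)).coeff j * x i ^ (j : ℕ) := by
    intro i
    have hlt : (P i (d i)).natDegree < n := by
      have h1 := hdeg i (d i)
      have h2 := MvPolynomial.degreeOf_le_iff.1 (hp i) d hd
      omega
    rw [← Finset.sum_range (fun j => (P i (d i)).coeff j * x i ^ j),
      ← Polynomial.eval_eq_sum_range' hlt]
    simp [hP]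
  simp_rw [hterm]
  rw [Finset.prod_univ_sum, Finset.mul_sum]
  rw [Fintype.piFinset_univ]
  refine Finset.sum_congr rfl fun α _ => ?_
  rw [Finset.prod_mul_distrib, mul_assoc]

theorem aux_count {D K : ℕ} (hK : 0 < K) (y : Fin D → ℝ) (hy : ∀ i, 0 ≤ y i ∧ y i ≤ 1)
    (ρ : ℝ) (hρ : 0 < ρ) (hρ1 : ρ ≤ 1) (hρK : 4 ≤ ρ * K) :
    ∃ m : ℕ, ρ * K / 2 ≤ m ∧ ∃ e : (Fin D → Fin m) → (Fin D → Fin K), Function.Injective e ∧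
      ∀ j, ∀ x ∈ cell D K (e j), ‖x - y‖ ≤ ρ := by
  have hK' : (0 : ℝ) < K := by exact_mod_cast hK
  have hf1 : ρ * K < ⌊ρ * K⌋₊ + 1 := Nat.lt_floor_add_one _
  have hf2 : (⌊ρ * K⌋₊ : ℝ) ≤ ρ * K := Nat.floor_le (by positivity)
  have hf3 : 1 ≤ ⌊ρ * K⌋₊ := Nat.le_floor (by push_cast; linarith)
  obtain ⟨m, hm⟩ := Nat.exists_eq_add_of_le hf3
  rw [hm] at hf1 hf2
  push_cast at hf1 hf2
  set α : Fin D → ℝ := fun i => max (y i - ρ) 0 with hα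
  have hα0 : ∀ i, 0 ≤ α i := fun i => le_max_right _ _
  have hα1 : ∀ i, α i + ρ ≤ 1 := by
    intro i
    have : α i ≤ 1 - ρ := max_le (by linarith [(hy i).2]) (by linarith)
    linarith
  have hα2 : ∀ i, α i ≤ y i := fun i => max_le (by linarith) (hy i).1
  have hα3 : ∀ i, y i ≤ α i + ρ := by
    intro i
    have : y i - ρ ≤ α i := le_max_left _ _
    linarith
  set A : Fin D → ℕ := fun i => ⌈α i * K⌉₊ with hA
  have hA1 : ∀ i, α i * K ≤ A i := fun i => Nat.le_ceil _
  have hA2 : ∀ i, (A i : ℝ) < α i * K + 1 :=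
    fun i => Nat.ceil_lt_add_one (mul_nonneg (hα0 i) hK'.le)
  have hAm' : ∀ i, (A i : ℝ) + m ≤ (α i + ρ) * K := by
    intro i
    have := hA2 i
    nlinarith
  have hAK : ∀ i, A i + m ≤ K := by
    intro i
    have h1 : (α i + ρ) * K ≤ 1 * K := mul_le_mul_of_nonneg_right (hα1 i) hK'.le
    have h2 := hAm' i
    have : ((A i + m : ℕ) : ℝ) ≤ (K : ℝ) := by push_cast; linarith
    exact_mod_cast this
  refine ⟨m, by linarith, fun j i => ⟨A i + j i, by have := hAK i; have := (j i).2; omega⟩, ?_, ?_⟩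
  · intro j j' h
    funext i
    have := congrArg Fin.val (congrFun h i)
    simp only at this
    exact Fin.ext (by omega)
  · intro j x hx
    rw [pi_norm_le_iff_of_nonneg hρ.le]
    intro i
    have h := hx i
    simp only at h
    have hj : ((j i : ℕ) : ℝ) + 1 ≤ m := by exact_mod_cast (j i).2
    have hj0 : (0 : ℝ) ≤ ((j i : ℕ) : ℝ) := by positivity
    rw [div_le_iff₀ hK', lt_div_iff₀ hK'] at h
    push_cast at h
    have l1 : α i ≤ x i := by
      have : α i * K ≤ x i * K := by linarith [hA1 i, h.1]
      exact le_of_mul_le_mul_right this hK'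
    have l2 : x i ≤ α i + ρ := by
      have : x i * K ≤ (α i + ρ) * K := by linarith [hAm' i, h.2]
      exact le_of_mul_le_mul_right this hK'
    rw [Real.norm_eq_abs, abs_le, Pi.sub_apply]
    constructor <;> linarith [hα2 i, hα3 i]

theorem aux_cell_disj {D M : ℕ} (hM : 0 < M) {k k' : Fin D → Fin M} {x : Fin D → ℝ}
    (h : x ∈ cell D M k) (h' : x ∈ cell D M k') : k = k' := by
  have hM' : (0 : ℝ) < M := by exact_mod_cast hM
  funext i
  have h1 := h i
  have h2 := h' i
  rw [div_le_iff₀ hM', lt_div_iff₀ hM'] at h1 h2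
  have a1 : ((k i : ℕ) : ℝ) < ((k' i : ℕ) : ℝ) + 1 := by linarith
  have a2 : ((k' i : ℕ) : ℝ) < ((k i : ℕ) : ℝ) + 1 := by linarith
  have b1 : (k i : ℕ) < (k' i : ℕ) + 1 := by exact_mod_cast a1
  have b2 : (k' i : ℕ) < (k i : ℕ) + 1 := by exact_mod_cast a2
  exact Fin.ext (by omega)

theorem aux_cell_cover {D M : ℕ} (hM : 0 < M) {x : Fin D → ℝ} (h : x ∈ unitCube D) :
    ∃ k, x ∈ cell D M k := by
  have hM' : (0 : ℝ) < M := by exact_mod_cast hM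
  have hnn : ∀ i, 0 ≤ x i * M := fun i => mul_nonneg (h i).1.le hM'.le
  refine ⟨fun i => ⟨⌊x i * M⌋₊, ?_⟩, fun i => ?_⟩
  · rw [Nat.floor_lt (hnn i)]
    have := (h i).2
    nlinarith
  · simp only
    rw [div_le_iff₀ hM', lt_div_iff₀ hM']
    exact ⟨Nat.floor_le (hnn i), Nat.lt_floor_add_one _⟩

theorem aux_cell_meas {D M : ℕ} (hM : 0 < M) (k : Fin D → Fin M) :
    MeasurableSet (cell D M k) ∧ volume (cell D M k) ≠ ⊤ ∧
      volume.real (cell D M k) = (1 / M : ℝ) ^ D := by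
  have hM' : (0 : ℝ) < M := by exact_mod_cast hM
  have e : cell D M k = Set.pi Set.univ
      (fun i => Set.Ico (((k i : ℕ) : ℝ) / M) ((((k i : ℕ) : ℝ) + 1) / M)) := by
    ext x; simp [cell]
  rw [e]
  refine ⟨MeasurableSet.univ_pi fun _ => measurableSet_Ico, ?_, ?_⟩
  · rw [Real.volume_pi_Ico]
    exact ENNReal.prod_ne_top fun _ _ => ENNReal.ofReal_ne_top
  · rw [Measure.real, Real.volume_pi_Ico_toReal]
    · simp [← sub_div]
    · intro i
      simp only
      gcongr
      linarith

theorem aux_integral {D M n : ℕ} (hM : 0 < M) (v : (Fin D → ℝ) → ℝ) (S : ℝ)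
    (c : (Fin D → Fin M) → (Fin D → Fin n) → ℝ)
    (hv : ∀ k, ∀ x ∈ cell D M k, |v x| ≤ S * ‖c k‖) :
    ∫ x in unitCube D, (v x) ^ 2 ≤ S ^ 2 * ∑ k, (1 / M : ℝ) ^ D * ‖c k‖ ^ 2 := by
  rw [← integral_indicator (aux_isOpen_unitCube D).measurableSet]
  have hint : ∀ k ∈ (Finset.univ : Finset (Fin D → Fin M)), Integrable
      ((cell D M k).indicator (fun _ => (S * ‖c k‖) ^ 2)) volume := by
    intro k _
    rw [integrable_indicator_iff (aux_cell_meas hM k).1]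
    exact integrableOn_const (aux_cell_meas hM k).2.1
  calc ∫ x, (unitCube D).indicator (fun x => (v x) ^ 2) x
      ≤ ∫ x, ∑ k, (cell D M k).indicator (fun _ => (S * ‖c k‖) ^ 2) x := by
        apply integral_mono_of_nonneg
        · filter_upwards with x
          exact Set.indicator_nonneg (fun _ _ => sq_nonneg _) x
        · exact integrable_finsetSum _ hint
        · filter_upwards with x
          have hnn : ∀ k ∈ (Finset.univ : Finset (Fin D → Fin M)),
              0 ≤ (cell D M k).indicator (fun _ => (S * ‖c k‖) ^ 2) x :=
            fun k _ => Set.indicator_nonneg (fun _ _ => sq_nonneg _) x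
          by_cases hx : x ∈ unitCube D
          · obtain ⟨k, hk⟩ := aux_cell_cover hM hx
            refine le_trans ?_ (Finset.single_le_sum hnn (Finset.mem_univ k))
            rw [Set.indicator_of_mem hx, Set.indicator_of_mem hk]
            rw [← sq_abs]
            exact pow_le_pow_left₀ (abs_nonneg _) (hv k x hk) 2
          · rw [Set.indicator_of_notMem hx]
            exact Finset.sum_nonneg hnn
    _ = _ := by
        rw [integral_finsetSum _ hint, Finset.mul_sum]
        refine Finset.sum_congr rfl fun k _ => ?_
        rw [integral_indicator_const _ (aux_cell_meas hM k).1, (aux_cell_meas hM k).2.2,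
          smul_eq_mul]
        ring

/-- coercivity / positive definiteness of the discrete form.
Let `n ≥ 2`.  There are constants `d₀ ∈ (0,1)` and `c > 0` depending only on the velocity
field (through `F`), `n`, `D` and `T` such that whenever `h = dσ` with `0 < d ≤ d₀`
(equivalently `M ≤ d₀ K` for `σ = 1/M`, `h = 1/K`), for every `t ∈ [0,T]`, every
admissible particle placement and every spline `v_σ ∈ V_σ^n(Ω)`:
`Σ_i w_i v_σ(x_i(t))² ≥ c ‖v_σ‖²_{L²(Ω)}`; in particular the symmetric bilinear form
`(u,v) ↦ Σ_i w_i u(x_i(t)) v(x_i(t))` is positive definite on `V_σ^n(Ω)`. -/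
theorem discrete_form_coercive
    (D : ℕ) (hD : 0 < D) (T : ℝ) (hT : 0 < T) (F : FlowData D T)
    (n : ℕ) (hn : 2 ≤ n) :
    ∃ d₀ c : ℝ, d₀ ∈ Set.Ioo (0 : ℝ) 1 ∧ 0 < c ∧
      ∀ M K : ℕ, 0 < M → 0 < K → (M : ℝ) ≤ d₀ * (K : ℝ) →
      ∀ x0 : (Fin D → Fin K) → (Fin D → ℝ), (∀ k, x0 k ∈ cell D K k) →
      ∀ t ∈ Set.Icc (0 : ℝ) T,
        (∀ v : (Fin D → ℝ) → ℝ, IsSpline D M n v →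
          c * ∫ x in unitCube D, (v x) ^ 2 ≤
            ∑ k : Fin D → Fin K, ((1 : ℝ) / K) ^ D * (v (F.X 0 t (x0 k))) ^ 2) ∧
        (∀ v : (Fin D → ℝ) → ℝ, IsSpline D M n v → (∃ x ∈ unitCube D, v x ≠ 0) →
          0 < ∑ k : Fin D → Fin K, ((1 : ℝ) / K) ^ D * (v (F.X 0 t (x0 k))) ^ 2) := by
  classical
  obtain ⟨ε, r, hε, hr, hr1, hpoly⟩ := aux_compact D n
  obtain ⟨L, hL1, hL⟩ := aux_flow_lip F
  have hL0 : 0 < L := by linarith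
  set S : ℝ := (Fintype.card (Fin D → Fin n) : ℝ) with hS
  have hS0 : 0 < S := by
    have : Nonempty (Fin D → Fin n) := ⟨fun _ => ⟨0, by omega⟩⟩
    rw [hS]
    exact_mod_cast Fintype.card_pos
  set γ : ℝ := (r / (4 * L)) ^ D * ε ^ 2 with hγ
  have hγ0 : 0 < γ := by positivity
  refine ⟨min (1 / 2) (r / (8 * L)), γ / S ^ 2, ⟨lt_min (by norm_num) (by positivity),
    (min_le_left _ _).trans_lt (by norm_num)⟩, by positivity, ?_⟩
  intro M K hM hK hMK x0 hx0 t ht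
  have hM' : (0 : ℝ) < M := by exact_mod_cast hM
  have hM1 : (1 : ℝ) ≤ M := by exact_mod_cast hM
  have hK' : (0 : ℝ) < K := by exact_mod_cast hK
  have hMK' : (M : ℝ) ≤ r / (8 * L) * K :=
    hMK.trans (mul_le_mul_of_nonneg_right (min_le_right _ _) hK'.le)
  have hx0m : ∀ k i, 0 ≤ x0 k i ∧ x0 k i ≤ 1 := by
    intro k i
    have h := hx0 k i
    have h1 : (0 : ℝ) ≤ ((k i : ℕ) : ℝ) / K := by positivity
    have h2 : (((k i : ℕ) : ℝ) + 1) / K ≤ 1 := by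
      rw [div_le_one hK']
      exact_mod_cast (k i).2
    exact ⟨h1.trans h.1, h.2.le.trans h2⟩
  -- local polynomial representation
  have hrep : ∀ v : (Fin D → ℝ) → ℝ, IsSpline D M n v →
      ∃ c : (Fin D → Fin M) → (Fin D → Fin n) → ℝ,
        ∀ k, ∀ x ∈ cell D M k, v x = qev (c k) (fun i => M * x i - ((k i : ℕ) : ℝ)) := by
    intro v hv
    have : ∀ k : Fin D → Fin M, ∃ c : (Fin D → Fin n) → ℝ,
        ∀ x ∈ cell D M k, v x = qev c (fun i => M * x i - ((k i : ℕ) : ℝ)) := by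
      intro k
      obtain ⟨p, hp, hpe⟩ := hv.2 k
      obtain ⟨c, hc⟩ := aux_repr (by omega) p hp (fun i => ((k i : ℕ) : ℝ) / M) (1 / M)
      refine ⟨c, fun x hx => ?_⟩
      rw [hpe x hx, ← hc]
      congr 2
      funext i
      field_simp
      ring
    choose c hc using this
    exact ⟨c, hc⟩
  -- the main lower bound
  have hlow : ∀ v : (Fin D → ℝ) → ℝ, ∀ c : (Fin D → Fin M) → (Fin D → Fin n) → ℝ,
      (∀ k, ∀ x ∈ cell D M k, v x = qev (c k) (fun i => M * x i - ((k i : ℕ) : ℝ))) →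
      γ * ∑ k, (1 / M : ℝ) ^ D * ‖c k‖ ^ 2 ≤
        ∑ k : Fin D → Fin K, ((1 : ℝ) / K) ^ D * (v (F.X 0 t (x0 k))) ^ 2 := by
    intro v c hc
    set f : (Fin D → Fin K) → ℝ := fun k => ((1 : ℝ) / K) ^ D * (v (F.X 0 t (x0 k))) ^ 2 with hf
    have hfnn : ∀ k, 0 ≤ f k := fun k => by positivity
    have hloc : ∀ q : Fin D → Fin M, γ * ((1 / M : ℝ) ^ D * ‖c q‖ ^ 2) ≤
        ∑ k, if F.X 0 t (x0 k) ∈ cell D M q then f k else 0 := by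
      intro q
      have hnn : ∀ k, 0 ≤ (if F.X 0 t (x0 k) ∈ cell D M q then f k else 0) := by
        intro k; split_ifs
        · exact hfnn k
        · exact le_rfl
      by_cases hq : c q = 0
      · rw [hq]
        simpa using Finset.sum_nonneg fun k _ => hnn k
      obtain ⟨z, hz0, hzb, hz⟩ := hpoly (c q) hq
      set Z : Fin D → ℝ := fun i => (((q i : ℕ) : ℝ) + z i) / M with hZ
      have hZm : ∀ i, 0 ≤ Z i ∧ Z i ≤ 1 := by
        intro i
        have h0 := (hz0 i).1
        have h1 := (hz0 i).2
        refine ⟨by positivity, ?_⟩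
        rw [hZ, div_le_one hM']
        have : ((q i : ℕ) : ℝ) + 1 ≤ M := by exact_mod_cast (q i).2
        linarith
      set y := F.X t 0 Z with hy
      have hym := aux_invariant F t ht Z hZm
      have hXy : F.X 0 t y = Z := F.flow_inv t 0 Z
      set ρ : ℝ := r / (2 * L * M) with hρ
      have hρ0 : 0 < ρ := by positivity
      have hρ1 : ρ ≤ 1 := by
        rw [hρ, div_le_one (by positivity)]
        nlinarith
      have hρK : 4 ≤ ρ * K := by
        rw [hρ, div_mul_eq_mul_div, le_div_iff₀ (by positivity)]
        rw [div_mul_eq_mul_div, le_div_iff₀ (by positivity)] at hMK'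
        linarith
      obtain ⟨m, hm, e, he, hecell⟩ := aux_count hK y hym ρ hρ0 hρ1 hρK
      have hgood : ∀ j, F.X 0 t (x0 (e j)) ∈ cell D M q ∧
          ε * ‖c q‖ ≤ |v (F.X 0 t (x0 (e j)))| := by
        intro j
        set w := F.X 0 t (x0 (e j)) with hw
        have h1 : ‖w - Z‖ ≤ L * ρ := by
          rw [← hXy]
          refine (hL t ht _ _ (hx0m _) hym).trans ?_
          exact mul_le_mul_of_nonneg_left (hecell j _ (hx0 _)) hL0.le
        have h2 : L * ρ * M < r := by
          rw [hρ]
          have : L * (r / (2 * L * M)) * M = r / 2 := by field_simp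
          rw [this]; linarith
        have hb : (fun i => M * w i - ((q i : ℕ) : ℝ)) ∈ Metric.ball z r := by
          rw [mem_ball_iff_norm, pi_norm_lt_iff hr]
          intro i
          have h3 : |w i - Z i| ≤ L * ρ := (norm_le_pi_norm (w - Z) i).trans h1
          have h4 : M * w i - ((q i : ℕ) : ℝ) - z i = (w i - Z i) * M := by
            simp only [hZ]; field_simp; ring
          rw [Pi.sub_apply, h4, Real.norm_eq_abs, abs_mul, abs_of_pos hM']
          exact (mul_le_mul_of_nonneg_right h3 hM'.le).trans_lt h2
        have hcell : w ∈ cell D M q := by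
          intro i
          have h := hzb hb i
          have ha := h.1
          have hb' := h.2
          rw [div_le_iff₀ hM', lt_div_iff₀ hM']
          constructor <;> linarith
        refine ⟨hcell, ?_⟩
        rw [hc q w hcell]
        exact hz _ hb
      calc γ * ((1 / M : ℝ) ^ D * ‖c q‖ ^ 2)
          = (ρ * K / 2) ^ D * ((1 / K : ℝ) ^ D * (ε * ‖c q‖) ^ 2) := by
            have : ρ * K / 2 * (1 / K) = r / (4 * L) * (1 / M) := by
              rw [hρ]; field_simp; norm_num
            calc γ * ((1 / M : ℝ) ^ D * ‖c q‖ ^ 2)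
                = (r / (4 * L) * (1 / M)) ^ D * (ε * ‖c q‖) ^ 2 := by
                  rw [hγ, mul_pow, mul_pow]; ring
              _ = _ := by rw [← this, mul_pow]; ring
        _ ≤ (m : ℝ) ^ D * ((1 / K : ℝ) ^ D * (ε * ‖c q‖) ^ 2) := by
            gcongr
        _ = ∑ _j : Fin D → Fin m, (1 / K : ℝ) ^ D * (ε * ‖c q‖) ^ 2 := by
            simp
        _ ≤ ∑ j : Fin D → Fin m,
              (if F.X 0 t (x0 (e j)) ∈ cell D M q then f (e j) else 0) := by
            refine Finset.sum_le_sum fun j _ => ?_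
            rw [if_pos (hgood j).1]
            simp only [hf]
            rw [← sq_abs (v _)]
            have := (hgood j).2
            gcongr
        _ = ∑ k ∈ Finset.univ.image e,
              (if F.X 0 t (x0 k) ∈ cell D M q then f k else 0) := by
            rw [Finset.sum_image (fun a _ b _ h => he h)]
        _ ≤ _ := Finset.sum_le_sum_of_subset_of_nonneg (Finset.subset_univ _)
            (fun k _ _ => hnn k)
    rw [Finset.mul_sum]
    refine (Finset.sum_le_sum fun q _ => hloc q).trans ?_
    rw [Finset.sum_comm]
    refine Finset.sum_le_sum fun k _ => ?_
    by_cases hex : ∃ q, F.X 0 t (x0 k) ∈ cell D M q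
    · obtain ⟨q, hq⟩ := hex
      rw [Finset.sum_eq_single q, if_pos hq]
      · intro q' _ hne
        rw [if_neg]
        intro h
        exact hne (aux_cell_disj hM h hq)
      · intro h; exact absurd (Finset.mem_univ _) h
    · push Not at hex
      rw [Finset.sum_eq_zero (fun q _ => if_neg (hex q))]
      exact hfnn k
  constructor
  · intro v hv
    obtain ⟨c, hc⟩ := hrep v hv
    refine le_trans ?_ (hlow v c hc)
    have hI := aux_integral hM v S c (by
      intro k x hx
      rw [hc k x hx]
      apply aux_qev_le
      intro i
      have h := hx i
      rw [div_le_iff₀ hM', lt_div_iff₀ hM'] at h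
      constructor <;> linarith)
    calc γ / S ^ 2 * ∫ x in unitCube D, (v x) ^ 2
        ≤ γ / S ^ 2 * (S ^ 2 * ∑ k, (1 / M : ℝ) ^ D * ‖c k‖ ^ 2) := by gcongr
      _ = γ * ∑ k, (1 / M : ℝ) ^ D * ‖c k‖ ^ 2 := by field_simp
  · rintro v hv ⟨x, hx, hvx⟩
    obtain ⟨c, hc⟩ := hrep v hv
    refine lt_of_lt_of_le ?_ (hlow v c hc)
    obtain ⟨q, hq⟩ := aux_cell_cover hM hx
    have hcq : c q ≠ 0 := by
      intro h0
      apply hvx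
      rw [hc q x hq, h0]
      simp [qev]
    have hpos : 0 < ‖c q‖ := norm_pos_iff.2 hcq
    apply mul_pos hγ0
    exact Finset.sum_pos' (fun k _ => by positivity) ⟨q, Finset.mem_univ q, by positivity⟩

end
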